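/- arXiv:2605.12756 — 2 statements merged into one kernel-verified Lean document; each statement's English description precedes it below -/
import Mathlib

section
/- Let m ≥ 2, let G = {g_1,…,g_{|G|}} be a 2-transitive permutation group on {1,…,m}, and let v ∈ ℝ^m be nonzero with Σ_i v_i = 0. Let C = [ρ(g_j)v]_{j=1}^{|G|} ∈ ℝ^{m×|G|}, and choose the compatible SVD C = γ U Vᵀ whose left singular vectors (the columns of U ∈ ℝ^{m×(m−1)}) form an orthonormal basis of the zero-sum subspace V_0, with V ∈ ℝ^{|G|×(m−1)} having orthonormal columns and γ = √(|G|/(m−1)) ‖v‖₂. For any diagonal matrix Σ = diag(s_1,…,s_{m−1}) with s_k ≥ 0, set Z = U Σ Vᵀ and let Ξ have columns Ξ_{:,j} = σ(Z_{:,j}). Then the columns of Ξ form the orbit of a single vector under G (i.e., there exists y_Ξ ∈ ℝ^m with Ξ_{:,j} = ρ(g_j) y_Ξ for all j) if and only if Σ is a scalar multiple of the identity matrix I_{m−1}. -/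
open scoped BigOperators
open Matrix

/-- Softmax function: `σ(z)_i = exp(z_i) / ∑_k exp(z_k)`. -/
noncomputable def softmax {m : ℕ} (u : Fin m → ℝ) : Fin m → ℝ :=
  fun i => Real.exp (u i) / ∑ k, Real.exp (u k)

/-- The real permutation matrix `ρ(g)` of a permutation `g`, acting on coordinates. -/
def permMat {m : ℕ} (g : Equiv.Perm (Fin m)) : Matrix (Fin m) (Fin m) ℝ :=
  Matrix.of fun i j => if i = g j then 1 else 0

/-- A permutation group on `{1,…,m}` is 2-transitive if any ordered pair of distinct indices
can be mapped to any other ordered pair of distinct indices by some group element. -/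
def IsTwoTransitive {m : ℕ} (G : Subgroup (Equiv.Perm (Fin m))) : Prop :=
  ∀ x1 x2 y1 y2 : Fin m, x1 ≠ x2 → y1 ≠ y2 → ∃ g ∈ G, g x1 = y1 ∧ g x2 = y2

lemma permMat_mulVec_apply {m : ℕ} (g : Equiv.Perm (Fin m)) (y : Fin m → ℝ) (i : Fin m) :
    (permMat g *ᵥ y) i = y (g⁻¹ i) := by
  simp only [permMat, Matrix.mulVec, dotProduct, Matrix.of_apply, ite_mul, one_mul, zero_mul]
  rw [Finset.sum_eq_single (g⁻¹ i)]
  · simp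
  · intro j _ hj
    rw [if_neg]
    rintro rfl
    simp at hj
  · simp

/-- Softmax is equivariant under permutations of the coordinates. -/
lemma softmax_comp_perm {m : ℕ} (g : Equiv.Perm (Fin m)) (u : Fin m → ℝ) :
    softmax (fun i => u (g i)) = fun i => softmax u (g i) := by
  funext i
  simp only [softmax]
  rw [Equiv.sum_comp g fun k => Real.exp (u k)]

/-- Softmax is injective on vectors with the same coordinate sum. -/
lemma eq_of_softmax_eq {m : ℕ} (hm : 0 < m) {u w : Fin m → ℝ}
    (hsum : ∑ i, u i = ∑ i, w i) (h : softmax u = softmax w) : u = w := by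
  have hne : (Finset.univ : Finset (Fin m)).Nonempty := ⟨⟨0, hm⟩, Finset.mem_univ _⟩
  have hpos : ∀ x : Fin m → ℝ, 0 < ∑ k, Real.exp (x k) := fun x =>
    Finset.sum_pos (fun k _ => Real.exp_pos _) hne
  have hlog : ∀ (x : Fin m → ℝ) i,
      Real.log (softmax x i) = x i - Real.log (∑ k, Real.exp (x k)) := fun x i => by
    rw [softmax, Real.log_div (Real.exp_ne_zero _) (hpos x).ne', Real.log_exp]
  have hdiff : ∀ i, u i - w i =
      Real.log (∑ k, Real.exp (u k)) - Real.log (∑ k, Real.exp (w k)) := fun i => by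
    have := hlog u i
    rw [h, hlog w i] at this
    linarith
  have hzero : (m : ℝ) *
      (Real.log (∑ k, Real.exp (u k)) - Real.log (∑ k, Real.exp (w k))) = 0 := by
    have hs : ∑ i, (u i - w i) = 0 := by rw [Finset.sum_sub_distrib, hsum, sub_self]
    rwa [Finset.sum_congr rfl fun i _ => hdiff i, Finset.sum_const, Finset.card_univ,
      Fintype.card_fin, nsmul_eq_mul] at hs
  have hm' : (m : ℝ) ≠ 0 := by exact_mod_cast hm.ne'
  funext i
  have := hdiff i
  rw [(mul_eq_zero.mp hzero).resolve_left hm'] at this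
  linarith

/-- A matrix invariant under a 2-transitive group is constant on and off the diagonal. -/
lemma IsTwoTransitive.exists_invariant_eq {m : ℕ} (hm : 2 ≤ m)
    {G : Subgroup (Equiv.Perm (Fin m))} (hG : IsTwoTransitive G)
    {T : Matrix (Fin m) (Fin m) ℝ} (hT : ∀ g ∈ G, ∀ i j, T (g i) (g j) = T i j) :
    ∃ c a : ℝ, T = c • (1 : Matrix (Fin m) (Fin m) ℝ) + Matrix.of fun _ _ => a := by
  have : Nontrivial (Fin m) := Fin.nontrivial_iff_two_le.mpr hm
  obtain ⟨p, q, hpq⟩ := exists_pair_ne (Fin m)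
  refine ⟨T p p - T p q, T p q, ?_⟩
  ext i j
  by_cases hij : i = j
  · subst hij
    obtain ⟨j, hj⟩ := exists_ne i
    obtain ⟨g, hg, rfl, -⟩ := hG p q i j hpq hj.symm
    simp [hT g hg]
  · obtain ⟨g, hg, rfl, rfl⟩ := hG p q i j hpq hij
    simp [hT g hg, hpq]

/-- Orbit structure of softmax columns for 2-transitive group actions.  With
`C = [ρ(g)v]_{g∈G} = γ U Vᵀ` the compatible SVD (columns of `U` an orthonormal basis of the
zero-sum subspace, `γ = √(|G|/(m−1))·‖v‖₂`), for any nonnegative diagonal `Σ = diag(s)` and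
`Z = U Σ Vᵀ`, the softmax columns `Ξ_{:,g} = σ(Z_{:,g})` form a single `G`-orbit iff `Σ` is a
scalar multiple of the identity. -/
theorem orbit_softmax_two_transitive
    (m : ℕ) (hm : 2 ≤ m) (G : Subgroup (Equiv.Perm (Fin m))) [Fintype G]
    (hG : IsTwoTransitive G)
    (v : Fin m → ℝ) (hv : v ≠ 0) (hv0 : ∑ i, v i = 0)
    (C : Matrix (Fin m) G ℝ)
    (hC : ∀ g : G, (fun i => C i g) = (permMat (g : Equiv.Perm (Fin m))) *ᵥ v)
    (γ : ℝ)
    (hγ : γ = Real.sqrt ((Fintype.card G : ℝ) / ((m : ℝ) - 1)) * Real.sqrt (∑ i, v i ^ 2))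
    (U : Matrix (Fin m) (Fin (m - 1)) ℝ) (V : Matrix G (Fin (m - 1)) ℝ)
    (hU : Uᵀ * U = 1) (hUsum : ∀ k, ∑ i, U i k = 0) (hV : Vᵀ * V = 1)
    (hCUV : C = γ • (U * Vᵀ))
    (s : Fin (m - 1) → ℝ) (hs : ∀ k, 0 ≤ s k)
    (Z : Matrix (Fin m) G ℝ) (hZ : Z = U * Matrix.diagonal s * Vᵀ)
    (Ξ : Matrix (Fin m) G ℝ)
    (hΞ : ∀ g : G, (fun i => Ξ i g) = softmax (fun i => Z i g)) :
    (∃ yΞ : Fin m → ℝ,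
        ∀ g : G, (fun i => Ξ i g) = (permMat (g : Equiv.Perm (Fin m))) *ᵥ yΞ) ↔
    (∃ c : ℝ, Matrix.diagonal s = c • (1 : Matrix (Fin (m - 1)) (Fin (m - 1)) ℝ)) := by
  have hm1 : (0 : ℝ) < (m : ℝ) - 1 := by
    have : (2 : ℝ) ≤ m := by exact_mod_cast hm
    linarith
  have hγ0 : γ ≠ 0 := by
    obtain ⟨i, hi⟩ := Function.ne_iff.mp hv
    have hcard : (0 : ℝ) < Fintype.card G := by exact_mod_cast Fintype.card_pos
    have hnorm : 0 < ∑ i, v i ^ 2 :=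
      Finset.sum_pos' (fun _ _ => sq_nonneg _) ⟨i, Finset.mem_univ _, sq_pos_of_ne_zero hi⟩
    rw [hγ]
    positivity
  have hCapp : ∀ (g : G) i, C i g = v ((g : Equiv.Perm (Fin m))⁻¹ i) := fun g i => by
    exact (congrFun (hC g) i).trans (permMat_mulVec_apply _ v i)
  constructor
  · rintro ⟨y, hy⟩
    have hZsum : ∀ g, ∑ i, Z i g = 0 := fun g => by
      simp only [hZ, Matrix.mul_assoc, Matrix.mul_apply (M := U)]
      rw [Finset.sum_comm]
      simp [← Finset.sum_mul, hUsum]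
    have hZ1 : ∀ (g : G) i, Z i g = Z ((g : Equiv.Perm (Fin m))⁻¹ i) 1 := fun g => by
      refine congrFun (eq_of_softmax_eq (by omega) ?_ ?_)
      · rw [hZsum, Equiv.sum_comp (g : Equiv.Perm (Fin m))⁻¹ fun i => Z i 1, hZsum]
      · rw [softmax_comp_perm _ fun i => Z i 1, ← hΞ, ← hΞ, hy, hy]
        funext i
        simp [permMat_mulVec_apply]
    have hT : U * Matrix.diagonal s * Uᵀ = γ⁻¹ • (Z * Cᵀ) := by
      rw [hCUV, hZ, Matrix.transpose_smul, Matrix.mul_smul, smul_smul, inv_mul_cancel₀ hγ0,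
        one_smul, Matrix.transpose_mul, Matrix.transpose_transpose, Matrix.mul_assoc _ Vᵀ,
        ← Matrix.mul_assoc Vᵀ, hV, Matrix.one_mul]
    have hinv : ∀ h ∈ G, ∀ i j, (U * Matrix.diagonal s * Uᵀ) (h i) (h j) =
        (U * Matrix.diagonal s * Uᵀ) i j := fun h hh i j => by
      rw [hT]
      simp only [Matrix.smul_apply, Matrix.mul_apply, Matrix.transpose_apply]
      rw [← Equiv.sum_comp (Equiv.mulLeft (⟨h, hh⟩ : G))]
      congr 1
      refine Finset.sum_congr rfl fun g _ => ?_
      rw [hZ1, hZ1 g, hCapp, hCapp]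
      simp
    obtain ⟨c, a, hca⟩ := hG.exists_invariant_eq hm hinv
    refine ⟨c, ?_⟩
    have hconst : (Matrix.of fun _ _ => a : Matrix (Fin m) (Fin m) ℝ) * U = 0 := by
      ext i k
      simp [Matrix.mul_apply, ← Finset.mul_sum, hUsum]
    calc Matrix.diagonal s = (Uᵀ * U) * Matrix.diagonal s * (Uᵀ * U) := by simp [hU]
      _ = Uᵀ * ((U * Matrix.diagonal s * Uᵀ) * U) := by simp only [Matrix.mul_assoc]
      _ = c • 1 := by
        rw [hca, Matrix.add_mul, hconst, add_zero, Matrix.smul_mul, Matrix.one_mul,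
          Matrix.mul_smul, hU]
  · rintro ⟨c, hc⟩
    have hZC : Z = (c * γ⁻¹) • C := by
      rw [hZ, hc, hCUV, smul_smul, mul_assoc, inv_mul_cancel₀ hγ0]
      simp
    refine ⟨softmax fun i => (c * γ⁻¹) * v i, fun g => ?_⟩
    have hcol : (fun i => Z i g) =
        fun i => (c * γ⁻¹) * v ((g : Equiv.Perm (Fin m))⁻¹ i) := by
      funext i
      rw [hZC, Matrix.smul_apply, hCapp, smul_eq_mul]
    rw [hΞ, hcol, softmax_comp_perm _ fun i => (c * γ⁻¹) * v i]
    funext i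
    rw [permMat_mulVec_apply]
end

section
/- Let m ≥ 2, let y ∈ Δ^{m−1} be a nonuniform probability vector, and let Y ∈ ℝ^{m×m!} have columns {g_j ∘ y} for an enumeration {g_1,…,g_{m!}} of S_m. Fix E_W, E_H > 0 and d ≥ m, and assume the active-constraints condition. Let α ∈ Δ^{m−1} be the unique solution of k(α_i − y_i) + log α_i = (1/m)Σ_{r=1}^m log α_r (i = 1,…,m), Σ_i α_i = 1, with k = √(E_W E_H / (m!(m−1)Σ_i(α_i − y_i)²)). Let A = [g_j ∘ α]_{j=1}^{m!}, C = A − Y, and let C = U(γ I_{m−1})Vᵀ be its rank-(m−1) SVD with U ∈ ℝ^{m×(m−1)}, V ∈ ℝ^{m!×(m−1)} having orthonormal columns and γ = √(m!/(m−1))·‖α − y‖₂. Then (W*, H*) is a global minimizer of the constrained layer-peeled problem if and only if W* = √(E_W/(m−1)) U Qᵀ and H* = −√(E_H/(m−1)) Q Vᵀ for some partial orthogonal matrix Q ∈ ℝ^{d×(m−1)} with QᵀQ = I_{m−1}. -/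
open scoped BigOperators
open Matrix

/-- Cross-entropy loss `L(q, p) = −∑ᵢ pᵢ log qᵢ`. -/
noncomputable def crossEnt {m : ℕ} (q p : Fin m → ℝ) : ℝ :=
  -∑ i, p i * Real.log (q i)

/-- Squared Frobenius norm `‖A‖_F²`. -/
noncomputable def frobSq {m n : Type*} [Fintype m] [Fintype n] (A : Matrix m n ℝ) : ℝ :=
  ∑ i, ∑ j, (A i j) ^ 2

/-- The layer-peeled objective `J(W,H;Y) = ∑ⱼ L(σ((WH)_{:,j}), Y_{:,j})`. -/
noncomputable def lpObj {m d : ℕ} {n : Type*} [Fintype n]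
    (W : Matrix (Fin m) (Fin d) ℝ) (H : Matrix (Fin d) n ℝ) (Y : Matrix (Fin m) n ℝ) : ℝ :=
  ∑ j, crossEnt (softmax (fun i => (W * H) i j)) (fun i => Y i j)

/-- `(W, H)` is a global minimizer of the constrained layer-peeled problem
`min J(W,H;Y)` subject to `‖W‖_F² ≤ E_W` and `‖H‖_F² ≤ E_H`. -/
def IsGlobalMin {m d : ℕ} {n : Type*} [Fintype n] (EW EH : ℝ) (Y : Matrix (Fin m) n ℝ)
    (W : Matrix (Fin m) (Fin d) ℝ) (H : Matrix (Fin d) n ℝ) : Prop :=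
  frobSq W ≤ EW ∧ frobSq H ≤ EH ∧
  ∀ (W' : Matrix (Fin m) (Fin d) ℝ) (H' : Matrix (Fin d) n ℝ),
    frobSq W' ≤ EW → frobSq H' ≤ EH → lpObj W H Y ≤ lpObj W' H' Y

section CrossEntropy

variable {m : ℕ}

theorem sum_exp_pos [NeZero m] (u : Fin m → ℝ) : 0 < ∑ k, Real.exp (u k) :=
  Finset.sum_pos (fun _ _ => Real.exp_pos _) Finset.univ_nonempty

theorem softmax_pos [NeZero m] (u : Fin m → ℝ) (i : Fin m) : 0 < softmax u i :=
  div_pos (Real.exp_pos _) (sum_exp_pos u)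

theorem sum_softmax [NeZero m] (u : Fin m → ℝ) : ∑ i, softmax u i = 1 := by
  unfold softmax
  rw [← Finset.sum_div, div_self (sum_exp_pos u).ne']

theorem softmax_eq_of_eq_log_sub {a u : Fin m → ℝ} {c : ℝ} (ha : ∀ i, 0 < a i)
    (hsum : ∑ i, a i = 1) (hu : ∀ i, u i = Real.log (a i) - c) : softmax u = a := by
  have hexp : ∀ i, Real.exp (u i) = a i * Real.exp (-c) := fun i => by
    rw [hu, sub_eq_add_neg, Real.exp_add, Real.exp_log (ha i)]
  funext i
  simp only [softmax, hexp, ← Finset.sum_mul, hsum, one_mul]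
  exact mul_div_cancel_right₀ _ (Real.exp_pos _).ne'

theorem crossEnt_softmax [NeZero m] (u : Fin m → ℝ) {p : Fin m → ℝ} (hp : ∑ i, p i = 1) :
    crossEnt (softmax u) p = Real.log (∑ k, Real.exp (u k)) - ∑ i, p i * u i := by
  have h : ∀ i, p i * Real.log (softmax u i)
      = p i * u i - p i * Real.log (∑ k, Real.exp (u k)) := fun i => by
    rw [softmax, Real.log_div (Real.exp_pos _).ne' (sum_exp_pos u).ne', Real.log_exp, mul_sub]
  simp only [crossEnt, h, Finset.sum_sub_distrib, ← Finset.sum_mul, hp]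
  ring

/-- The mean increment `∑ a i * (v i - u i)` for `a = softmax u` controls the ratio of
partition functions, strictly unless the increment is constant. -/
theorem log_sum_exp_sub [NeZero m] (u v : Fin m → ℝ) :
    Real.log (∑ k, Real.exp (v k)) - Real.log (∑ k, Real.exp (u k))
      = ∑ i, softmax u i * (v i - u i)
        + Real.log (∑ i, softmax u i
            * Real.exp (v i - u i - ∑ l, softmax u l * (v l - u l))) := by
  set c := ∑ l, softmax u l * (v l - u l) with hc
  have h : ∑ i, softmax u i * Real.exp (v i - u i - c)
      = (∑ k, Real.exp (v k)) / (∑ k, Real.exp (u k)) * Real.exp (-c) := by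
    rw [Finset.sum_div, Finset.sum_mul]
    refine Finset.sum_congr rfl fun i _ => ?_
    rw [softmax, sub_eq_add_neg _ c, Real.exp_add, Real.exp_sub]
    field_simp
  rw [h, Real.log_mul (div_pos (sum_exp_pos v) (sum_exp_pos u)).ne' (Real.exp_pos _).ne',
    Real.log_div (sum_exp_pos v).ne' (sum_exp_pos u).ne', Real.log_exp]
  ring

theorem sum_softmax_mul_add_one [NeZero m] (u w : Fin m → ℝ) :
    ∑ i, softmax u i * (w i - ∑ l, softmax u l * w l + 1) = 1 := by
  simp only [mul_add, mul_sub, Finset.sum_add_distrib, Finset.sum_sub_distrib,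
    ← Finset.sum_mul, sum_softmax]
  ring

theorem crossEnt_softmax_sub [NeZero m] (u v : Fin m → ℝ) {p : Fin m → ℝ}
    (hp : ∑ i, p i = 1) :
    crossEnt (softmax v) p = crossEnt (softmax u) p + ∑ i, (softmax u i - p i) * (v i - u i)
      + Real.log (∑ i, softmax u i
            * Real.exp (v i - u i - ∑ l, softmax u l * (v l - u l))) := by
  have h := log_sum_exp_sub u v
  have hsplit : ∑ i, (softmax u i - p i) * (v i - u i)
      = ∑ i, softmax u i * (v i - u i) - (∑ i, p i * v i - ∑ i, p i * u i) := by
    simp only [← Finset.sum_sub_distrib]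
    exact Finset.sum_congr rfl fun i _ => by ring
  rw [crossEnt_softmax v hp, crossEnt_softmax u hp, hsplit]
  linarith

/-- First-order convexity inequality for the cross-entropy of a softmax. -/
theorem le_crossEnt_softmax [NeZero m] (u v : Fin m → ℝ) {p : Fin m → ℝ}
    (hp : ∑ i, p i = 1) :
    crossEnt (softmax u) p + ∑ i, (softmax u i - p i) * (v i - u i)
      ≤ crossEnt (softmax v) p := by
  rw [crossEnt_softmax_sub u v hp]
  refine le_add_of_nonneg_right (Real.log_nonneg ?_)
  rw [← sum_softmax_mul_add_one u fun i => v i - u i]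
  exact Finset.sum_le_sum fun i _ =>
    mul_le_mul_of_nonneg_left (Real.add_one_le_exp _) (softmax_pos u i).le

/-- Equality in `le_crossEnt_softmax` forces the two logit vectors to differ by a constant. -/
theorem sub_eq_of_crossEnt_softmax_le [NeZero m] (u v : Fin m → ℝ) {p : Fin m → ℝ}
    (hp : ∑ i, p i = 1)
    (h : crossEnt (softmax v) p
      ≤ crossEnt (softmax u) p + ∑ i, (softmax u i - p i) * (v i - u i)) (i : Fin m) :
    v i - u i = ∑ l, softmax u l * (v l - u l) := by
  rw [crossEnt_softmax_sub u v hp] at h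
  by_contra hne
  refine absurd h (not_le.mpr (lt_add_of_pos_right _ (Real.log_pos ?_)))
  rw [← sum_softmax_mul_add_one u fun i => v i - u i]
  exact Finset.sum_lt_sum
    (fun i _ => mul_le_mul_of_nonneg_left (Real.add_one_le_exp _) (softmax_pos u i).le)
    ⟨i, Finset.mem_univ i, mul_lt_mul_of_pos_left
      (Real.add_one_lt_exp (sub_ne_zero.mpr hne)) (softmax_pos u i)⟩

end CrossEntropy

section Frobenius

variable {a b r n : Type*} [Fintype a] [Fintype b] [Fintype r] [Fintype n]

theorem frobSq_eq_trace (M : Matrix a b ℝ) : frobSq M = (Mᵀ * M).trace := by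
  simp only [frobSq, Matrix.trace, Matrix.diag, Matrix.mul_apply, Matrix.transpose_apply]
  rw [Finset.sum_comm]
  simp only [sq]

theorem frobSq_nonneg (M : Matrix a b ℝ) : 0 ≤ frobSq M :=
  Finset.sum_nonneg fun _ _ => Finset.sum_nonneg fun _ _ => sq_nonneg _

theorem eq_zero_of_frobSq_nonpos {M : Matrix a b ℝ} (h : frobSq M ≤ 0) : M = 0 := by
  rw [frobSq_eq_trace] at h
  have h0 : (Mᵀ * M).trace = 0 := le_antisymm h (frobSq_eq_trace M ▸ frobSq_nonneg M)
  rw [← Matrix.conjTranspose_eq_transpose_of_trivial] at h0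
  exact Matrix.trace_conjTranspose_mul_self_eq_zero_iff.mp h0

theorem sum_sum_mul_eq_trace (M N : Matrix a b ℝ) :
    ∑ j, ∑ i, M i j * N i j = (Mᵀ * N).trace := by
  simp only [Matrix.trace, Matrix.diag, Matrix.mul_apply, Matrix.transpose_apply]

theorem frobSq_transpose (M : Matrix a b ℝ) : frobSq Mᵀ = frobSq M := by
  simp only [frobSq, Matrix.transpose_apply]
  exact Finset.sum_comm

theorem frobSq_smul (c : ℝ) (M : Matrix a b ℝ) : frobSq (c • M) = c ^ 2 * frobSq M := by
  simp only [frobSq, Matrix.smul_apply, smul_eq_mul, mul_pow, Finset.mul_sum]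

theorem frobSq_neg (M : Matrix a b ℝ) : frobSq (-M) = frobSq M := by
  simp only [frobSq, Matrix.neg_apply, neg_sq]

theorem frobSq_add (M N : Matrix a b ℝ) :
    frobSq (M + N) = frobSq M + frobSq N + 2 * (Mᵀ * N).trace := by
  rw [← sum_sum_mul_eq_trace, Finset.sum_comm]
  simp only [frobSq, Finset.mul_sum, ← Finset.sum_add_distrib, Matrix.add_apply]
  exact Finset.sum_congr rfl fun _ _ => Finset.sum_congr rfl fun _ _ => by ring

theorem frobSq_isometry_mul [DecidableEq r] {U : Matrix a r ℝ} (hU : Uᵀ * U = 1)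
    (M : Matrix r b ℝ) : frobSq (U * M) = frobSq M := by
  rw [frobSq_eq_trace, frobSq_eq_trace, Matrix.transpose_mul, Matrix.mul_assoc,
    ← Matrix.mul_assoc Uᵀ, hU, Matrix.one_mul]

theorem frobSq_eq_add_residual [DecidableEq r] {U : Matrix a r ℝ} (hU : Uᵀ * U = 1)
    (M : Matrix a b ℝ) : frobSq M = frobSq (Uᵀ * M) + frobSq (M - U * (Uᵀ * M)) := by
  have hcross : (U * (Uᵀ * M))ᵀ * (M - U * (Uᵀ * M)) = 0 := by
    rw [Matrix.transpose_mul, Matrix.mul_assoc, Matrix.mul_sub, ← Matrix.mul_assoc Uᵀ U, hU,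
      Matrix.one_mul, sub_self, Matrix.mul_zero]
  have h := frobSq_add (U * (Uᵀ * M)) (M - U * (Uᵀ * M))
  rw [add_sub_cancel, hcross, Matrix.trace_zero, frobSq_isometry_mul hU] at h
  linarith

theorem frobSq_isometry [DecidableEq r] {U : Matrix a r ℝ} (hU : Uᵀ * U = 1) :
    frobSq U = Fintype.card r := by
  rw [frobSq_eq_trace, hU, Matrix.trace_one]

theorem trace_transpose_isometry_mul (U : Matrix a r ℝ) (V : Matrix n r ℝ)
    (W : Matrix a b ℝ) (H : Matrix b n ℝ) :
    ((U * Vᵀ)ᵀ * (W * H)).trace = (Uᵀ * W * (H * V)).trace := by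
  rw [Matrix.transpose_mul, Matrix.transpose_transpose, Matrix.mul_assoc, Matrix.trace_mul_comm]
  simp only [Matrix.mul_assoc]

/-- Sum-of-squares form of the bound `-‖W‖ ‖H‖ ≤ ⟨U Vᵀ, W H⟩` for isometries `U`, `V`. -/
theorem weighted_frobSq_identity [DecidableEq r] {U : Matrix a r ℝ} {V : Matrix n r ℝ}
    (hU : Uᵀ * U = 1) (hV : Vᵀ * V = 1) (W : Matrix a b ℝ) (H : Matrix b n ℝ) (s t : ℝ) :
    t ^ 2 * frobSq W + s ^ 2 * frobSq H + 2 * (s * t) * (Uᵀ * W * (H * V)).trace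
      = t ^ 2 * frobSq (W - U * (Uᵀ * W)) + s ^ 2 * frobSq (H - H * V * Vᵀ)
        + frobSq (t • (Uᵀ * W) + s • (H * V)ᵀ) := by
  have hW := frobSq_eq_add_residual hU W
  have hH := frobSq_eq_add_residual hV Hᵀ
  have e1 : Vᵀ * Hᵀ = (H * V)ᵀ := (Matrix.transpose_mul _ _).symm
  have e2 : Hᵀ - V * (H * V)ᵀ = (H - H * V * Vᵀ)ᵀ := by
    rw [Matrix.transpose_sub, Matrix.transpose_mul (H * V), Matrix.transpose_transpose]
  rw [e1, e2, frobSq_transpose, frobSq_transpose, frobSq_transpose] at hH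
  have e3 : ((t • (Uᵀ * W))ᵀ * (s • (H * V)ᵀ)).trace = s * t * (Uᵀ * W * (H * V)).trace := by
    rw [Matrix.transpose_smul, Matrix.smul_mul, Matrix.mul_smul, Matrix.trace_smul,
      Matrix.trace_smul, ← Matrix.transpose_mul, Matrix.trace_transpose, smul_eq_mul,
      smul_eq_mul, Matrix.trace_mul_comm]
    ring
  rw [frobSq_add, e3, frobSq_smul, frobSq_smul, frobSq_transpose, hW, hH]
  ring

end Frobenius

section Optimality

variable {m d : ℕ} {n r : Type*} [Fintype n] [Fintype r]

theorem le_lpObj [NeZero m] {Y Z : Matrix (Fin m) n ℝ} (hY : ∀ j, ∑ i, Y i j = 1)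
    (W : Matrix (Fin m) (Fin d) ℝ) (H : Matrix (Fin d) n ℝ) :
    ∑ j, crossEnt (softmax fun i => Z i j) (fun i => Y i j)
      + ∑ j, ∑ i, (softmax (fun i => Z i j) i - Y i j) * ((W * H) i j - Z i j)
      ≤ lpObj W H Y := by
  rw [← Finset.sum_add_distrib]
  exact Finset.sum_le_sum fun j _ => le_crossEnt_softmax _ _ (hY j)

/-- Equality in `le_lpObj` determines the logits once their column sums are known. -/
theorem mul_eq_of_lpObj_le [NeZero m] {Y Z : Matrix (Fin m) n ℝ} (hY : ∀ j, ∑ i, Y i j = 1)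
    {W : Matrix (Fin m) (Fin d) ℝ} {H : Matrix (Fin d) n ℝ}
    (hsum : ∀ j, ∑ i, (W * H) i j = ∑ i, Z i j)
    (h : lpObj W H Y ≤ ∑ j, crossEnt (softmax fun i => Z i j) (fun i => Y i j)
      + ∑ j, ∑ i, (softmax (fun i => Z i j) i - Y i j) * ((W * H) i j - Z i j)) :
    W * H = Z := by
  rw [← Finset.sum_add_distrib] at h
  have hle := fun j (_ : j ∈ Finset.univ) => le_crossEnt_softmax
    (fun i => Z i j) (fun i => (W * H) i j) (hY j)
  have heq := (Finset.sum_eq_sum_iff_of_le hle).mp (le_antisymm (Finset.sum_le_sum hle) h)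
  ext i j
  have hc := sub_eq_of_crossEnt_softmax_le (fun i => Z i j) (fun i => (W * H) i j) (hY j)
    (heq j (Finset.mem_univ j)).ge
  set c := ∑ l, softmax (fun i => Z i j) l * ((W * H) l j - Z l j)
  have hmc : ∑ i, ((W * H) i j - Z i j) = ∑ _i : Fin m, c := Finset.sum_congr rfl fun i _ => hc i
  rw [Finset.sum_sub_distrib, hsum j, sub_self, Finset.sum_const, Finset.card_univ,
    Fintype.card_fin, nsmul_eq_mul] at hmc
  have hc0 : c = 0 := (mul_eq_zero.mp hmc.symm).resolve_left (NeZero.ne _)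
  exact sub_eq_zero.mp ((hc i).trans hc0)

/-- If the gradient of the loss at the logits `-(√E_W √E_H / r) • U Vᵀ` is a positive multiple of
`U Vᵀ`, where `U` and `V` have `r` orthonormal columns, then the global minimizers are exactly
the balanced factorizations of these logits. -/
theorem isGlobalMin_iff_of_gradient_eq_smul [NeZero m] [DecidableEq r] [Nonempty r]
    {EW EH γ : ℝ} (hEW : 0 < EW) (hEH : 0 < EH) (hγ : 0 < γ)
    {Y : Matrix (Fin m) n ℝ} (hY : ∀ j, ∑ i, Y i j = 1)
    {U : Matrix (Fin m) r ℝ} {V : Matrix n r ℝ} (hU : Uᵀ * U = 1) (hV : Vᵀ * V = 1)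
    {Z : Matrix (Fin m) n ℝ}
    (hZ : Z = -(Real.sqrt EW * Real.sqrt EH / Fintype.card r) • (U * Vᵀ))
    (hgrad : ∀ i j, softmax (fun i => Z i j) i - Y i j = γ * (U * Vᵀ) i j)
    {Q₀ : Matrix (Fin d) r ℝ} (hQ₀ : Q₀ᵀ * Q₀ = 1)
    (W : Matrix (Fin m) (Fin d) ℝ) (H : Matrix (Fin d) n ℝ) :
    IsGlobalMin EW EH Y W H ↔
      ∃ Q : Matrix (Fin d) r ℝ, Qᵀ * Q = 1 ∧
        W = Real.sqrt (EW / Fintype.card r) • (U * Qᵀ) ∧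
        H = -(Real.sqrt (EH / Fintype.card r) • (Q * Vᵀ)) := by
  have hρ : (0 : ℝ) < Fintype.card r := Nat.cast_pos.mpr Fintype.card_pos
  set ρ : ℝ := (Fintype.card r : ℝ)
  have hs : 0 < Real.sqrt EW := Real.sqrt_pos.mpr hEW
  have ht : 0 < Real.sqrt EH := Real.sqrt_pos.mpr hEH
  have hs2 : Real.sqrt EW ^ 2 = EW := Real.sq_sqrt hEW.le
  have ht2 : Real.sqrt EH ^ 2 = EH := Real.sq_sqrt hEH.le
  have hq : 0 < Real.sqrt ρ := Real.sqrt_pos.mpr hρ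
  have hq2 : Real.sqrt ρ ^ 2 = ρ := Real.sq_sqrt hρ.le
  rw [Real.sqrt_div hEW.le, Real.sqrt_div hEH.le]
  set s := Real.sqrt EW
  set t := Real.sqrt EH
  set q := Real.sqrt ρ
  set J := ∑ j, crossEnt (softmax fun i => Z i j) (fun i => Y i j)
  have hcol : ∀ l, ∑ i, U i l = 0 := by
    have h1 : (1 : Fin m → ℝ) ᵥ* (U * Vᵀ) = 0 := by
      funext j
      have h : ∑ i, (softmax (fun i => Z i j) i - Y i j) = 0 := by
        rw [Finset.sum_sub_distrib, sum_softmax, hY, sub_self]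
      simp only [hgrad, ← Finset.mul_sum] at h
      simpa [Matrix.vecMul, dotProduct] using (mul_eq_zero.mp h).resolve_left hγ.ne'
    have h2 : (1 : Fin m → ℝ) ᵥ* U = 0 := by
      have h := congrArg (· ᵥ* V) h1
      simpa only [Matrix.vecMul_vecMul, Matrix.mul_assoc, hV, Matrix.mul_one,
        Matrix.zero_vecMul] using h
    intro l
    simpa [Matrix.vecMul, dotProduct] using congrFun h2 l
  have hcolmul : ∀ (M : Matrix r n ℝ) j, ∑ i, (U * M) i j = 0 := fun M j => by
    simp only [Matrix.mul_apply]
    rw [Finset.sum_comm]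
    simp only [← Finset.sum_mul, hcol, zero_mul, Finset.sum_const_zero]
  have hlin : ∀ (W : Matrix (Fin m) (Fin d) ℝ) (H : Matrix (Fin d) n ℝ),
      ∑ j, ∑ i, (softmax (fun i => Z i j) i - Y i j) * ((W * H) i j - Z i j)
        = γ * ((Uᵀ * W * (H * V)).trace + s * t) := fun W H => by
    have hnorm : ((U * Vᵀ)ᵀ * (U * Vᵀ)).trace = ρ := by
      rw [← frobSq_eq_trace, frobSq_isometry_mul hU, frobSq_transpose, frobSq_isometry hV]
    have hterm : ∀ i j, (softmax (fun i => Z i j) i - Y i j) * ((W * H) i j - Z i j)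
        = γ * ((U * Vᵀ) i j * (W * H - Z) i j) := fun i j => by
      rw [hgrad, Matrix.sub_apply]; ring
    simp only [hterm, ← Finset.mul_sum]
    rw [sum_sum_mul_eq_trace, Matrix.mul_sub, Matrix.trace_sub, trace_transpose_isometry_mul, hZ,
      Matrix.mul_smul, Matrix.trace_smul, hnorm, smul_eq_mul]
    field_simp
    ring
  have htrace : ∀ (W : Matrix (Fin m) (Fin d) ℝ) (H : Matrix (Fin d) n ℝ),
      frobSq W ≤ EW → frobSq H ≤ EH →
      t ^ 2 * frobSq (W - U * (Uᵀ * W)) + s ^ 2 * frobSq (H - H * V * Vᵀ)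
        + frobSq (t • (Uᵀ * W) + s • (H * V)ᵀ)
        ≤ 2 * (s * t) * ((Uᵀ * W * (H * V)).trace + s * t) := fun W H hW hH => by
    rw [← weighted_frobSq_identity hU hV]
    rw [← hs2] at hW
    rw [← ht2] at hH
    have h1 := mul_le_mul_of_nonneg_left hW (sq_nonneg t)
    have h2 := mul_le_mul_of_nonneg_left hH (sq_nonneg s)
    linarith
  have hlower : ∀ (W : Matrix (Fin m) (Fin d) ℝ) (H : Matrix (Fin d) n ℝ),
      frobSq W ≤ EW → frobSq H ≤ EH → 0 ≤ (Uᵀ * W * (H * V)).trace + s * t :=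
    fun W H hW hH => by
      refine nonneg_of_mul_nonneg_right (le_trans ?_ (htrace W H hW hH)) (by positivity)
      have h1 := frobSq_nonneg (W - U * (Uᵀ * W))
      have h2 := frobSq_nonneg (H - H * V * Vᵀ)
      have h3 := frobSq_nonneg (t • (Uᵀ * W) + s • (H * V)ᵀ)
      positivity
  have hbound : ∀ (W : Matrix (Fin m) (Fin d) ℝ) (H : Matrix (Fin d) n ℝ),
      frobSq W ≤ EW → frobSq H ≤ EH → J ≤ lpObj W H Y := fun W H hW hH => by
    have h := le_lpObj (Z := Z) hY W H
    rw [hlin] at h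
    have := mul_nonneg hγ.le (hlower W H hW hH)
    linarith
  have hfact : ∀ Q : Matrix (Fin d) r ℝ, Qᵀ * Q = 1 →
      frobSq ((s / q) • (U * Qᵀ)) ≤ EW ∧ frobSq (-((t / q) • (Q * Vᵀ))) ≤ EH ∧
        lpObj ((s / q) • (U * Qᵀ)) (-((t / q) • (Q * Vᵀ))) Y = J := fun Q hQ => by
    refine ⟨?_, ?_, ?_⟩
    · rw [frobSq_smul, frobSq_isometry_mul hU, frobSq_transpose, frobSq_isometry hQ, div_pow,
        hs2, hq2, div_mul_cancel₀ _ hρ.ne']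
    · rw [frobSq_neg, frobSq_smul, frobSq_isometry_mul hQ, frobSq_transpose, frobSq_isometry hV,
        div_pow, ht2, hq2, div_mul_cancel₀ _ hρ.ne']
    · have hmul : ((s / q) • (U * Qᵀ)) * (-((t / q) • (Q * Vᵀ))) = Z := by
        rw [Matrix.mul_neg, Matrix.smul_mul, Matrix.mul_smul, smul_smul, Matrix.mul_assoc U,
          ← Matrix.mul_assoc Qᵀ, hQ, Matrix.one_mul, hZ, neg_smul, div_mul_div_comm, ← sq, hq2]
      rw [lpObj, hmul]
  constructor
  · rintro ⟨hW, hH, hmin⟩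
    obtain ⟨h₁, h₂, h₃⟩ := hfact Q₀ hQ₀
    have hWJ : lpObj W H Y ≤ J := h₃ ▸ hmin _ _ h₁ h₂
    have hle := le_lpObj (Z := Z) hY W H
    have hnn := hlower W H hW hH
    have hzero : (Uᵀ * W * (H * V)).trace + s * t = 0 := by
      rw [hlin] at hle
      refine le_antisymm (nonpos_of_mul_nonpos_right (a := γ) ?_ hγ) hnn
      linarith
    have hsq := htrace W H hW hH
    rw [hzero, mul_zero] at hsq
    have n1 := mul_nonneg (sq_nonneg t) (frobSq_nonneg (W - U * (Uᵀ * W)))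
    have n2 := mul_nonneg (sq_nonneg s) (frobSq_nonneg (H - H * V * Vᵀ))
    have n3 := frobSq_nonneg (t • (Uᵀ * W) + s • (H * V)ᵀ)
    have hWU : W = U * (Uᵀ * W) := sub_eq_zero.mp <| eq_zero_of_frobSq_nonpos <|
      nonpos_of_mul_nonpos_right (a := t ^ 2) (by linarith) (by positivity)
    have hHV : H = H * V * Vᵀ := sub_eq_zero.mp <| eq_zero_of_frobSq_nonpos <|
      nonpos_of_mul_nonpos_right (a := s ^ 2) (by linarith) (by positivity)
    have hPN : t • (Uᵀ * W) + s • (H * V)ᵀ = 0 := eq_zero_of_frobSq_nonpos (by linarith)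
    have hWH : W * H = Z := by
      refine mul_eq_of_lpObj_le hY (fun j => ?_) ?_
      · rw [hWU, Matrix.mul_assoc, hcolmul, hZ, ← Matrix.mul_smul, hcolmul]
      · rw [hlin, hzero, mul_zero, add_zero]
        exact hWJ
    have hprod : Uᵀ * W * (H * V) = -(s * t / ρ) • (1 : Matrix r r ℝ) := by
      rw [Matrix.mul_assoc, ← Matrix.mul_assoc W, hWH, hZ, Matrix.smul_mul, Matrix.mul_smul,
        Matrix.mul_assoc U, hV, Matrix.mul_one, hU]
    set P := Uᵀ * W
    set N := H * V
    have hN : N = -((t / s) • Pᵀ) := by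
      have h := congrArg Matrix.transpose hPN
      rw [Matrix.transpose_add, Matrix.transpose_smul, Matrix.transpose_smul,
        Matrix.transpose_transpose, Matrix.transpose_zero] at h
      have h' : s • N = -(t • Pᵀ) := eq_neg_of_add_eq_zero_right h
      rw [← inv_smul_smul₀ hs.ne' N, h', smul_neg, smul_smul, div_eq_inv_mul]
    refine ⟨(q / s) • Pᵀ, ?_, ?_, ?_⟩
    · rw [hN, Matrix.mul_neg, Matrix.mul_smul, neg_smul, neg_inj] at hprod
      have hPP : P * Pᵀ = (s ^ 2 / ρ) • (1 : Matrix r r ℝ) := by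
        have h := congrArg (fun M => (s / t) • M) hprod
        simp only [smul_smul] at h
        rw [div_mul_div_cancel₀ ht.ne', div_self hs.ne', one_smul] at h
        rw [h]
        congr 1
        field_simp
      rw [Matrix.transpose_smul, Matrix.transpose_transpose, Matrix.smul_mul, Matrix.mul_smul,
        hPP, smul_smul, smul_smul, ← hq2]
      have : q / s * (q / s) * (s ^ 2 / q ^ 2) = 1 := by field_simp
      rw [this, one_smul]
    · rw [Matrix.transpose_smul, Matrix.transpose_transpose, Matrix.mul_smul, smul_smul,
        div_mul_div_cancel₀ hq.ne', div_self hs.ne', one_smul]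
      exact hWU
    · rw [Matrix.smul_mul, smul_smul, div_mul_div_cancel₀ hq.ne', ← Matrix.smul_mul,
        ← Matrix.neg_mul, ← hN]
      exact hHV
  · rintro ⟨Q, hQ, rfl, rfl⟩
    obtain ⟨h₁, h₂, h₃⟩ := hfact Q hQ
    exact ⟨h₁, h₂, fun W' H' hW' hH' => h₃ ▸ hbound W' H' hW' hH'⟩

end Optimality

theorem permMat_mulVec {m : ℕ} (g : Equiv.Perm (Fin m)) (v : Fin m → ℝ) (i : Fin m) :
    (permMat g *ᵥ v) i = v (g.symm i) := by
  simp only [permMat, Matrix.mulVec, dotProduct, Matrix.of_apply, ite_mul, one_mul, zero_mul]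
  rw [Finset.sum_eq_single (g.symm i)] <;> aesop

theorem exists_transpose_mul_self_eq_one {d r : ℕ} (h : r ≤ d) :
    ∃ Q : Matrix (Fin d) (Fin r) ℝ, Qᵀ * Q = 1 := by
  refine ⟨Matrix.of fun i j => if i = Fin.castLE h j then 1 else 0, ?_⟩
  ext i j
  simp [Matrix.mul_apply, Matrix.one_apply, eq_comm]

/-- Optimal embeddings for the symmetric group: for the `S_m`-orbit target of a nonuniform
`y`, with `α` the solution of the closed system, `C = A − Y` with rank-`(m−1)` SVD
`C = γ·U Vᵀ`, under the active-constraints assumption, `(W, H)` is a global minimizer of the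
constrained layer-peeled problem iff `W = √(E_W/(m−1))·U Qᵀ` and `H = −√(E_H/(m−1))·Q Vᵀ`
for some partial orthogonal `Q` (`QᵀQ = I_{m−1}`). -/
theorem optimal_embeddings_symmetric_group
    (m d : ℕ) (hm : 2 ≤ m) (hd : m ≤ d)
    (y : Fin m → ℝ) (hy : y ∈ stdSimplex ℝ (Fin m)) (hyn : y ≠ fun _ => 1 / (m : ℝ))
    (EW EH : ℝ) (hEW : 0 < EW) (hEH : 0 < EH)
    (Y : Matrix (Fin m) (Equiv.Perm (Fin m)) ℝ)
    (hY : ∀ g : Equiv.Perm (Fin m), (fun i => Y i g) = permMat g *ᵥ y)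
    (hactive : ∀ (W : Matrix (Fin m) (Fin d) ℝ) (H : Matrix (Fin d) (Equiv.Perm (Fin m)) ℝ),
      IsGlobalMin EW EH Y W H → frobSq W = EW ∧ frobSq H = EH)
    (α : Fin m → ℝ) (hα : α ∈ stdSimplex ℝ (Fin m)) (hαpos : ∀ i, 0 < α i)
    (k : ℝ)
    (hk : k = Real.sqrt (EW * EH /
      ((m.factorial : ℝ) * ((m : ℝ) - 1) * ∑ i, (α i - y i) ^ 2)))
    (hsys : ∀ i, k * (α i - y i) + Real.log (α i) = (1 / (m : ℝ)) * ∑ r, Real.log (α r))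
    (A : Matrix (Fin m) (Equiv.Perm (Fin m)) ℝ)
    (hA : ∀ g : Equiv.Perm (Fin m), (fun i => A i g) = permMat g *ᵥ α)
    (C : Matrix (Fin m) (Equiv.Perm (Fin m)) ℝ) (hCdef : C = A - Y)
    (γ : ℝ)
    (hγ : γ = Real.sqrt ((m.factorial : ℝ) / ((m : ℝ) - 1)) *
      Real.sqrt (∑ i, (α i - y i) ^ 2))
    (U : Matrix (Fin m) (Fin (m - 1)) ℝ) (V : Matrix (Equiv.Perm (Fin m)) (Fin (m - 1)) ℝ)
    (hU : Uᵀ * U = 1) (hV : Vᵀ * V = 1) (hSVD : C = γ • (U * Vᵀ))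
    (W : Matrix (Fin m) (Fin d) ℝ) (H : Matrix (Fin d) (Equiv.Perm (Fin m)) ℝ) :
    IsGlobalMin EW EH Y W H ↔
      ∃ Q : Matrix (Fin d) (Fin (m - 1)) ℝ, Qᵀ * Q = 1 ∧
        W = Real.sqrt (EW / ((m : ℝ) - 1)) • (U * Qᵀ) ∧
        H = -(Real.sqrt (EH / ((m : ℝ) - 1)) • (Q * Vᵀ)) := by
  have : NeZero m := ⟨by omega⟩
  have : Nonempty (Fin (m - 1)) := ⟨⟨0, by omega⟩⟩
  have hcard : (Fintype.card (Fin (m - 1)) : ℝ) = (m : ℝ) - 1 := by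
    rw [Fintype.card_fin, Nat.cast_sub (by omega), Nat.cast_one]
  have hm1 : (0 : ℝ) < (m : ℝ) - 1 := hcard ▸ Nat.cast_pos.mpr Fintype.card_pos
  have hfac : (0 : ℝ) < m.factorial := Nat.cast_pos.mpr m.factorial_pos
  have hYg : ∀ i g, Y i g = y (g.symm i) := fun i g =>
    (congrFun (hY g) i).trans (permMat_mulVec g y i)
  have hAg : ∀ i g, A i g = α (g.symm i) := fun i g =>
    (congrFun (hA g) i).trans (permMat_mulVec g α i)
  have hS : 0 < ∑ i, (α i - y i) ^ 2 := by
    refine (Finset.sum_nonneg fun i _ => sq_nonneg _).lt_of_ne fun h0 => hyn ?_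
    have hk0 : k = 0 := by rw [hk, ← h0, mul_zero, div_zero, Real.sqrt_zero]
    have hαy : ∀ i, α i = y i := fun i => by
      have h := (Finset.sum_eq_zero_iff_of_nonneg fun i _ => sq_nonneg _).mp h0.symm i
        (Finset.mem_univ i)
      exact sub_eq_zero.mp (pow_eq_zero_iff two_ne_zero |>.mp h)
    have hconst : ∀ i j, α i = α j := fun i j => by
      refine Real.log_injOn_pos (hαpos i) (hαpos j) ?_
      have hi := hsys i
      have hj := hsys j
      rw [hk0, zero_mul, zero_add] at hi hj
      rw [hi, hj]
    funext i
    have h1 : ∑ j, α j = m * α i := by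
      rw [Finset.sum_congr rfl fun j _ => hconst j i, Finset.sum_const, Finset.card_univ,
        Fintype.card_fin, nsmul_eq_mul]
    rw [hα.2] at h1
    rw [← hαy i, eq_div_iff (NeZero.ne _), mul_comm]
    exact h1.symm
  have hγpos : 0 < γ := by
    rw [hγ]
    exact mul_pos (Real.sqrt_pos.mpr (div_pos hfac hm1)) (Real.sqrt_pos.mpr hS)
  have hkγ : k * γ = Real.sqrt EW * Real.sqrt EH / ((m : ℝ) - 1) := by
    rw [hk, hγ, ← Real.sqrt_mul (div_pos hfac hm1).le, ← Real.sqrt_mul (by positivity),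
      ← Real.sqrt_mul hEW.le, ← Real.sqrt_sq hm1.le, ← Real.sqrt_div (by positivity),
      Real.sqrt_sq hm1.le]
    congr 1
    field_simp
  have hZk : -(Real.sqrt EW * Real.sqrt EH / Fintype.card (Fin (m - 1))) • (U * Vᵀ)
      = -k • C := by
    rw [hSVD, smul_smul, hcard, neg_mul, hkγ]
  have hsoft : ∀ g, (softmax fun i => (-k • C) i g) = fun i => A i g := fun g => by
    refine softmax_eq_of_eq_log_sub (c := (1 / (m : ℝ)) * ∑ r, Real.log (α r))
      (fun i => hAg i g ▸ hαpos _) ?_ fun i => ?_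
    · simp only [hAg]
      rw [Equiv.sum_comp g.symm α, hα.2]
    · rw [hCdef, Matrix.smul_apply, Matrix.sub_apply, hAg, hYg, smul_eq_mul, ← hsys (g.symm i)]
      ring
  obtain ⟨Q₀, hQ₀⟩ := exists_transpose_mul_self_eq_one (show m - 1 ≤ d by omega)
  have key := isGlobalMin_iff_of_gradient_eq_smul hEW hEH hγpos (Y := Y)
    (fun g => by simp only [hYg]; rw [Equiv.sum_comp g.symm y, hy.2]) hU hV hZk.symm
    (fun i g => by
      rw [hsoft g, ← Matrix.sub_apply, ← hCdef, hSVD, Matrix.smul_apply, smul_eq_mul])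
    hQ₀ W H
  rwa [hcard] at key
end
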